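/- arXiv:1702.02837 — 3 statements merged into one kernel-verified Lean document; each statement's English description precedes it below -/
import Mathlib

section
/- Let γ_t be the 4×4 real matrix with rows (1, t, t²/2, t³/6), (0, 1, t, t²/2), (0, 0, 1, t), (0, 0, 0, 1). Let (x_n) be a sequence of nonzero vectors in ℝ⁴ converging to a vector x whose fourth coordinate is nonzero. Then the projective points [γ_n x_n] converge to [e₁] in ℙ(ℝ⁴) as n → ∞. -/
open Matrix Filter
open scoped LinearAlgebra.Projectivization

/-- The quotient topology on real projective space, induced from `(Fin 4 → ℝ) \ {0}`. -/
noncomputable instance : TopologicalSpace (ℙ ℝ (Fin 4 → ℝ)) := by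
  unfold Projectivization; infer_instance

/-- The one-parameter group of case (c1): a single Jordan block of size 4 with eigenvalue 0. -/
noncomputable def gammaC1 (t : ℝ) : Matrix (Fin 4) (Fin 4) ℝ :=
  !![1, t, t ^ 2 / 2, t ^ 3 / 6;
     0, 1, t, t ^ 2 / 2;
     0, 0, 1, t;
     0, 0, 0, 1]

lemma gammaC1_det (t : ℝ) : (gammaC1 t).det = 1 := by
  simp [gammaC1, Matrix.det_succ_row_zero, Fin.sum_univ_succ]

lemma gammaC1_mulVec_ne_zero (t : ℝ) {v : Fin 4 → ℝ} (hv : v ≠ 0) :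
    gammaC1 t *ᵥ v ≠ 0 := by
  have hinj : Function.Injective (gammaC1 t).mulVec :=
    Matrix.mulVec_injective_iff_isUnit.mpr
      ((Matrix.isUnit_iff_isUnit_det _).mpr (by simp [gammaC1_det]))
  intro h
  exact hv (hinj (h.trans (Matrix.mulVec_zero _).symm))

/-- The canonical map from nonzero vectors to real projective space is continuous. -/
lemma continuous_projectivization_mk :
    Continuous fun v : {v : Fin 4 → ℝ // v ≠ 0} => Projectivization.mk ℝ v.1 v.2 :=
  continuous_quotient_mk'

/-- Projective points converge as soon as suitably rescaled representatives converge. -/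
lemma tendsto_projectivization_mk_of_smul {ι : Type*} {l : Filter ι} {v : ι → Fin 4 → ℝ}
    (hv : ∀ i, v i ≠ 0) {w : Fin 4 → ℝ} (hw : w ≠ 0) {c : ι → ℝ} (hc : ∀ᶠ i in l, c i ≠ 0)
    (h : Tendsto (fun i => c i • v i) l (nhds w)) :
    Tendsto (fun i => Projectivization.mk ℝ (v i) (hv i)) l
      (nhds (Projectivization.mk ℝ w hw)) := by
  intro U hU
  obtain ⟨t, ht, htU⟩ := (mem_nhds_subtype _ _ _).1
    (continuous_projectivization_mk.tendsto ⟨w, hw⟩ hU)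
  rw [mem_map]
  filter_upwards [h ht, hc] with i hi hci
  have hmem := @htU ⟨c i • v i, smul_ne_zero hci (hv i)⟩ hi
  have heq : Projectivization.mk ℝ (v i) (hv i) =
      Projectivization.mk ℝ (c i • v i) (smul_ne_zero hci (hv i)) :=
    ((Projectivization.mk_eq_mk_iff' ℝ _ _ _ _).2 ⟨c i, rfl⟩).symm
  simpa only [Set.mem_preimage, heq] using hmem

/-- Rescaling `gammaC1 t *ᵥ v` by `t⁻³` gives an expression polynomial in `t⁻¹`. -/
lemma inv_pow_smul_gammaC1_mulVec {t : ℝ} (ht : t ≠ 0) (v : Fin 4 → ℝ) :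
    t⁻¹ ^ 3 • (gammaC1 t *ᵥ v) =
      ![t⁻¹ ^ 3 * v 0 + t⁻¹ ^ 2 * v 1 + t⁻¹ * v 2 / 2 + v 3 / 6,
        t⁻¹ ^ 3 * v 1 + t⁻¹ ^ 2 * v 2 + t⁻¹ * v 3 / 2,
        t⁻¹ ^ 3 * v 2 + t⁻¹ ^ 2 * v 3,
        t⁻¹ ^ 3 * v 3] := by
  ext i
  fin_cases i <;> simp [gammaC1, dotProduct, Fin.sum_univ_four] <;> field_simp

/-- The rescaled orbit converges to a multiple of the first basis vector. -/
lemma tendsto_inv_pow_smul_gammaC1_mulVec {ι : Type*} {l : Filter ι} {t : ι → ℝ}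
    (ht : Tendsto t l atTop) {x : ι → Fin 4 → ℝ} {x₀ : Fin 4 → ℝ} (hx : Tendsto x l (nhds x₀)) :
    Tendsto (fun i => (t i)⁻¹ ^ 3 • (gammaC1 (t i) *ᵥ x i)) l
      (nhds (Pi.single 0 (x₀ 3 / 6))) := by
  let F : ℝ × (Fin 4 → ℝ) → Fin 4 → ℝ := fun p =>
    ![p.1 ^ 3 * p.2 0 + p.1 ^ 2 * p.2 1 + p.1 * p.2 2 / 2 + p.2 3 / 6,
      p.1 ^ 3 * p.2 1 + p.1 ^ 2 * p.2 2 + p.1 * p.2 3 / 2,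
      p.1 ^ 3 * p.2 2 + p.1 ^ 2 * p.2 3,
      p.1 ^ 3 * p.2 3]
  have hF : Continuous F := by
    refine continuous_pi fun i => ?_
    fin_cases i <;> simp [F] <;> fun_prop
  have hF₀ : F (0, x₀) = Pi.single 0 (x₀ 3 / 6) := by
    ext i
    fin_cases i <;> simp [F]
  have hlim : Tendsto (fun i => F ((t i)⁻¹, x i)) l (nhds (F (0, x₀))) :=
    (hF.tendsto (0, x₀)).comp (ht.inv_tendsto_atTop.prodMk_nhds hx)
  rw [hF₀] at hlim
  refine hlim.congr' ?_
  filter_upwards [ht.eventually_ne_atTop 0] with i hi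
  exact (inv_pow_smul_gammaC1_mulVec hi (x i)).symm

theorem tendsto_proj_gammaC1 (x : ℕ → Fin 4 → ℝ) (hx : ∀ n, x n ≠ 0)
    (x₀ : Fin 4 → ℝ) (hlim : Tendsto x atTop (nhds x₀)) (hx4 : x₀ 3 ≠ 0) :
    Tendsto
      (fun n : ℕ =>
        Projectivization.mk ℝ (gammaC1 n *ᵥ x n) (gammaC1_mulVec_ne_zero _ (hx n)))
      atTop
      (nhds (Projectivization.mk ℝ (Pi.single 0 1)
        (by intro h; simpa using congrFun h 0))) := by
  have hn : Tendsto (fun n : ℕ => (n : ℝ)) atTop atTop := tendsto_natCast_atTop_atTop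
  refine tendsto_projectivization_mk_of_smul (c := fun n => 6 / x₀ 3 * (n : ℝ)⁻¹ ^ 3) _ _ ?_ ?_
  · filter_upwards [hn.eventually_ne_atTop 0] with n hn0
    positivity
  · have h := (tendsto_inv_pow_smul_gammaC1_mulVec hn hlim).const_smul (6 / x₀ 3)
    have hx₀ : 6 / x₀ 3 * (x₀ 3 / 6) = 1 := by field_simp
    simpa only [smul_smul, ← Pi.single_smul, smul_eq_mul, hx₀] using h
end

section
/- Let γ_t be the 4×4 real matrix with rows (1, t, t²/2, t³/6), (0, 1, t, t²/2), (0, 0, 1, t), (0, 0, 0, 1). Let (x_n) be a sequence of nonzero vectors in ℝ⁴ converging to a vector x whose fourth coordinate is nonzero. Then the projective points [γ_{−n} x_n] converge to [e₁] in ℙ(ℝ⁴) as n → ∞. -/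
open Matrix Filter
open scoped LinearAlgebra.Projectivization

lemma continuous_projectivization_mk' :
    Continuous (Projectivization.mk' ℝ : {v : Fin 4 → ℝ // v ≠ 0} → ℙ ℝ (Fin 4 → ℝ)) :=
  continuous_quotient_mk'

/-- The action of `gammaC1 (-u⁻¹)`, rescaled by `-6 u³ / a`, is polynomial in `u`. -/
lemma smul_gammaC1_neg_inv_mulVec {u : ℝ} (hu : u ≠ 0) (a : ℝ) (y : Fin 4 → ℝ) :
    (-6 * u ^ 3 / a) • (gammaC1 (-u⁻¹) *ᵥ y) =
      ![(y 3 - 3 * u * y 2 + 6 * u ^ 2 * y 1 - 6 * u ^ 3 * y 0) / a,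
        (-3 * u * y 3 + 6 * u ^ 2 * y 2 - 6 * u ^ 3 * y 1) / a,
        (6 * u ^ 2 * y 3 - 6 * u ^ 3 * y 2) / a,
        -6 * u ^ 3 * y 3 / a] := by
  ext i
  fin_cases i <;>
    simp [gammaC1, dotProduct, Fin.sum_univ_four] <;> field_simp <;> ring

theorem tendsto_proj_gammaC1_neg (x : ℕ → Fin 4 → ℝ) (hx : ∀ n, x n ≠ 0)
    (x₀ : Fin 4 → ℝ) (hlim : Tendsto x atTop (nhds x₀)) (hx4 : x₀ 3 ≠ 0) :
    Tendsto
      (fun n : ℕ =>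
        Projectivization.mk ℝ (gammaC1 (-(n : ℝ)) *ᵥ x n) (gammaC1_mulVec_ne_zero _ (hx n)))
      atTop
      (nhds (Projectivization.mk ℝ (Pi.single 0 1)
        (by intro h; simpa using congrFun h 0))) := by
  refine tendsto_projectivization_mk_of_smul (c := fun n : ℕ => -6 * (n : ℝ)⁻¹ ^ 3 / x₀ 3) _ _
    ?_ ?_
  · filter_upwards [eventually_ne_atTop 0] with n hn
    simp [hn, hx4]
  · have hu : Tendsto (fun n : ℕ => (n : ℝ)⁻¹) atTop (nhds 0) :=
      tendsto_inv_atTop_nhds_zero_nat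
    let F : ℝ × (Fin 4 → ℝ) → Fin 4 → ℝ := fun p =>
      ![(p.2 3 - 3 * p.1 * p.2 2 + 6 * p.1 ^ 2 * p.2 1 - 6 * p.1 ^ 3 * p.2 0) / x₀ 3,
        (-3 * p.1 * p.2 3 + 6 * p.1 ^ 2 * p.2 2 - 6 * p.1 ^ 3 * p.2 1) / x₀ 3,
        (6 * p.1 ^ 2 * p.2 3 - 6 * p.1 ^ 3 * p.2 2) / x₀ 3,
        -6 * p.1 ^ 3 * p.2 3 / x₀ 3]
    have hF : Continuous F := by
      refine continuous_pi fun i => ?_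
      fin_cases i <;> simp [F] <;> fun_prop
    have hF0 : F (0, x₀) = Pi.single 0 1 := by
      ext i
      fin_cases i <;> simp [F, hx4]
    rw [← hF0]
    refine ((hF.tendsto (0, x₀)).comp (hu.prodMk_nhds hlim)).congr' ?_
    filter_upwards [eventually_ne_atTop 0] with n hn
    have hn' : (n : ℝ)⁻¹ ≠ 0 := by simpa using hn
    have h := smul_gammaC1_neg_inv_mulVec hn' (x₀ 3) (x n)
    rw [inv_inv] at h
    exact h.symm
end

section
/- Let a₁, a₂, a₃, a₄ be pairwise distinct real numbers, and for s ∈ ℝ let γ_s = diag(e^{a₁ s}, e^{a₂ s}, e^{a₃ s}, e^{a₄ s}). If x ∈ ℝ⁴ has at least three nonzero coordinates and t ≠ 0, then the vectors x, γ_t x, γ_{2t} x span a linear subspace of ℝ⁴ of dimension at least 3. In particular, no 2-dimensional subspace containing such an x is invariant under all γ_s. -/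
open Matrix

/-- A vector with at least `n` nonzero coordinates has linearly independent images under the first
`n` powers of a diagonal matrix with distinct entries. -/
theorem linearIndependent_pow_mul_of_le_card_support {ι K : Type*} [Fintype ι] [Field K]
    [DecidableEq K] {n : ℕ} {b : ι → K} (hb : Function.Injective b) {x : ι → K}
    (hx : n ≤ (Finset.univ.filter fun i => x i ≠ 0).card) :
    LinearIndependent K fun (k : Fin n) (i : ι) => b i ^ (k : ℕ) * x i := by
  rw [Fintype.linearIndependent_iff]
  intro c hc
  obtain ⟨e⟩ : Nonempty (Fin n ↪ (Finset.univ.filter fun i => x i ≠ 0 : Finset ι)) :=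
    Function.Embedding.nonempty_of_card_le (by simpa only [Fintype.card_fin, Fintype.card_coe])
  have hc0 : c = 0 := by
    refine Matrix.eq_zero_of_forall_index_sum_pow_mul_eq_zero (f := fun j => b (e j))
      (fun i j hij => e.injective (Subtype.ext (hb hij))) fun j => ?_
    have hxj : x (e j) ≠ 0 := (Finset.mem_filter.mp (e j).2).2
    have hj := congrFun hc (e j)
    simp only [Finset.sum_apply, Pi.smul_apply, smul_eq_mul, Pi.zero_apply] at hj
    refine (mul_eq_zero.mp ?_).resolve_right hxj
    rw [Finset.sum_mul]
    exact (Finset.sum_congr rfl fun k _ => by ring).trans hj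
  exact fun k => congrFun hc0 k

theorem diagonal_orbit_spans_three_dims (a : Fin 4 → ℝ) (hinj : Function.Injective a)
    (x : Fin 4 → ℝ) (hx : 3 ≤ (Finset.univ.filter fun i => x i ≠ 0).card)
    (t : ℝ) (ht : t ≠ 0) :
    3 ≤ Module.finrank ℝ
        (Submodule.span ℝ
          ({x, (Matrix.diagonal fun i => Real.exp (a i * t)) *ᵥ x,
            (Matrix.diagonal fun i => Real.exp (a i * (2 * t))) *ᵥ x} :
            Set (Fin 4 → ℝ))) ∧
      ∀ U : Submodule ℝ (Fin 4 → ℝ), Module.finrank ℝ U = 2 → x ∈ U →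
        ¬ ∀ s : ℝ, ∀ u ∈ U, (Matrix.diagonal fun i => Real.exp (a i * s)) *ᵥ u ∈ U := by
  have hspan : 3 ≤ Module.finrank ℝ
      (Submodule.span ℝ
        ({x, (Matrix.diagonal fun i => Real.exp (a i * t)) *ᵥ x,
          (Matrix.diagonal fun i => Real.exp (a i * (2 * t))) *ᵥ x} :
          Set (Fin 4 → ℝ))) := by
    have hb : Function.Injective fun i => Real.exp (a i * t) := fun i j hij =>
      hinj (mul_right_cancel₀ ht (Real.exp_injective hij))
    have hli := linearIndependent_pow_mul_of_le_card_support hb (n := 3) (x := x)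
      (by convert hx)
    have hcard := finrank_span_eq_card hli
    rw [Fintype.card_fin] at hcard
    refine hcard.symm.le.trans (Submodule.finrank_mono (Submodule.span_mono ?_))
    rintro _ ⟨k, rfl⟩
    fin_cases k
    · left
      simp
    · right; left
      ext i
      simp [Matrix.mulVec_diagonal]
    · right; right
      ext i
      simp only [Matrix.mulVec_diagonal, ← Real.exp_nat_mul]
      norm_num
      left
      ring
  refine ⟨hspan, fun U hU hxU hinv => ?_⟩
  have hle := Submodule.finrank_mono (R := ℝ) (t := U) (Submodule.span_le.mpr
    (Set.insert_subset hxU (Set.insert_subset (hinv t x hxU)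
      (Set.singleton_subset_iff.mpr (hinv (2 * t) x hxU)))))
  omega
end
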